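/- Main theorem: two holomorphic automorphisms F, G of ℂⁿ are equal if and only if F(0) = G(0), DF(0) = DG(0), and the complex Hessians of log‖DF(0)⁻¹(F − F(0))‖ and log‖DG(0)⁻¹(G − G(0))‖ coincide on ℂⁿ \ {0}. -/

import Mathlib

noncomputable def levi {n : ℕ} (g : EuclideanSpace ℂ (Fin n) → ℝ)
    (z v w : EuclideanSpace ℂ (Fin n)) : ℂ :=
  (1/4 : ℂ) * ((((iteratedFDeriv ℝ 2 g z ![v, w]
      + iteratedFDeriv ℝ 2 g z ![Complex.I • v, Complex.I • w] : ℝ)) : ℂ)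
    + Complex.I * (((iteratedFDeriv ℝ 2 g z ![Complex.I • v, w]
      - iteratedFDeriv ℝ 2 g z ![v, Complex.I • w] : ℝ)) : ℂ))

open MeasureTheory Filter Topology Metric

set_option linter.unusedSectionVars false

section Regularity
variable {E E' : Type*} [NormedAddCommGroup E] [NormedSpace ℂ E] [FiniteDimensional ℂ E]
  [NormedAddCommGroup E'] [NormedSpace ℂ E'] [CompleteSpace E']

lemma aux_formula {F : E → E'} (hF : Differentiable ℂ F) (v x : E) :
    fderiv ℂ F x v = (2 * Real.pi * Complex.I)⁻¹ • ∫ θ in (0:ℝ)..2 * Real.pi,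
      (deriv (circleMap 0 1) θ * (1 / (circleMap 0 1 θ) ^ 2)) • F (x + circleMap 0 1 θ • v) := by
  have hd : Differentiable ℂ (fun t : ℂ => F (x + t • v)) := by fun_prop
  have h1 := (hd.differentiableOn (s := closedBall (0:ℂ) 1)).deriv_eq_smul_circleIntegral one_pos
  have h2 : HasDerivAt (fun t : ℂ => F (x + t • v)) (fderiv ℂ F x v) 0 := by
    have h3 : HasDerivAt (fun t : ℂ => x + t • v) v 0 := by
      simpa using ((hasDerivAt_id (0:ℂ)).smul_const v).const_add x
    have h4 : HasFDerivAt F (fderiv ℂ F x) (x + (0:ℂ) • v) := by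
      simpa using (hF x).hasFDerivAt
    exact h4.comp_hasDerivAt (0:ℂ) h3
  rw [h2.deriv] at h1
  rw [eq_inv_smul_iff₀ Complex.two_pi_I_ne_zero, ← h1]
  simp only [circleIntegral, sub_zero, smul_smul]

lemma aux_cont_coef : Continuous
    (fun θ : ℝ => (deriv (circleMap 0 1) θ * (1 / (circleMap 0 1 θ) ^ 2))) := by
  have : ∀ θ : ℝ, circleMap 0 1 θ ≠ 0 := fun θ => circleMap_ne_center one_ne_zero
  have h := continuous_circleMap 0 1
  simp only [deriv_circleMap]
  refine (h.mul continuous_const).mul (continuous_const.div (h.pow 2) fun θ => pow_ne_zero _ (this θ))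

lemma aux_cont {F : E → E'} (hF : Differentiable ℂ F) : Continuous (fderiv ℂ F) := by
  rw [continuous_clm_apply]
  intro v
  simp_rw [aux_formula hF v]
  refine continuous_const.smul ?_
  apply intervalIntegral.continuous_parametric_intervalIntegral_of_continuous'
  have h := hF.continuous
  have h1 := aux_cont_coef
  have h2 := continuous_circleMap 0 1
  exact (h1.comp continuous_snd).smul
    (h.comp (continuous_fst.add ((h2.comp continuous_snd).smul continuous_const)))

lemma aux_diff {F : E → E'} (hF : Differentiable ℂ F) (v : E) :
    Differentiable ℂ (fun x => fderiv ℂ F x v) := by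
  have : ProperSpace E := FiniteDimensional.proper ℂ E
  simp_rw [aux_formula hF v]
  refine Differentiable.const_smul ?_ _
  intro x₀
  have hF1 := aux_cont hF
  have h := hF.continuous
  have h1 := aux_cont_coef
  have h2 := continuous_circleMap 0 1
  have hc : Continuous (fun p : E × ℝ => 
      (deriv (circleMap 0 1) p.2 * (1 / (circleMap 0 1 p.2) ^ 2)) • 
        fderiv ℂ F (p.1 + circleMap 0 1 p.2 • v)) := 
    (h1.comp continuous_snd).smul
      (hF1.comp (continuous_fst.add ((h2.comp continuous_snd).smul continuous_const)))
  obtain ⟨M, hM⟩ := ((isCompact_closedBall x₀ 1).prod 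
    (isCompact_Icc (a := (0:ℝ)) (b := 2 * Real.pi))).exists_bound_of_continuousOn hc.continuousOn
  have key := intervalIntegral.hasFDerivAt_integral_of_dominated_of_fderiv_le (𝕜 := ℂ)
    (μ := volume) (a := 0) (b := 2 * Real.pi) (s := ball x₀ 1) (x₀ := x₀) (bound := fun _ => M)
    (F := fun x θ => (deriv (circleMap 0 1) θ * (1 / (circleMap 0 1 θ) ^ 2)) • 
      F (x + circleMap 0 1 θ • v))
    (F' := fun x θ => (deriv (circleMap 0 1) θ * (1 / (circleMap 0 1 θ) ^ 2)) • 
      fderiv ℂ F (x + circleMap 0 1 θ • v)) (ball_mem_nhds _ one_pos) ?_ ?_ ?_ ?_ ?_ ?_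
  · exact key.differentiableAt
  · refine Eventually.of_forall fun x => Continuous.aestronglyMeasurable ?_
    exact h1.smul (h.comp (continuous_const.add (h2.smul continuous_const)))
  · refine Continuous.intervalIntegrable ?_ _ _
    exact h1.smul (h.comp (continuous_const.add (h2.smul continuous_const)))
  · refine Continuous.aestronglyMeasurable ?_
    exact h1.smul (hF1.comp (continuous_const.add (h2.smul continuous_const)))
  · refine Eventually.of_forall fun θ hθ x hx => ?_
    rw [Set.uIoc_of_le (by positivity)] at hθ
    exact hM (x, θ) ⟨ball_subset_closedBall hx, hθ.1.le, hθ.2⟩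
  · exact intervalIntegrable_const
  · refine Eventually.of_forall fun θ hθ x hx => ?_
    refine HasFDerivAt.const_smul ?_ _
    have h3 : HasFDerivAt (fun x : E => x + circleMap 0 1 θ • v) (ContinuousLinearMap.id ℂ E) x :=
      (hasFDerivAt_id x).add_const _
    exact (hF _).hasFDerivAt.comp x h3

lemma aux_contDiff {F : E → E'} (hF : Differentiable ℂ F) : ContDiff ℂ 2 F := by
  have h1 : ∀ v, ContDiff ℂ 1 (fun x => fderiv ℂ F x v) := fun v => 
    contDiff_one_iff_fderiv.2 ⟨aux_diff hF v, aux_cont (aux_diff hF v)⟩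
  have h2 : ContDiff ℂ 1 (fderiv ℂ F) := contDiff_clm_apply_iff.2 h1
  rw [show (2 : WithTop ℕ∞) = 1 + 1 from by norm_num, contDiff_succ_iff_fderiv]
  exact ⟨hF, by simp, h2⟩
end Regularity

/-- one-variable automorphisms -/
lemma aux_recip {κ μ : ℂ → ℂ} (hκ : Differentiable ℂ κ) (hμ : Continuous μ)
    (hl : Function.LeftInverse μ κ) (h0 : κ 0 = 0) :
    Differentiable ℂ (fun t : ℂ => (κ t⁻¹)⁻¹) := by
  have hne : ∀ t, t ≠ 0 → κ t ≠ 0 := fun t ht h => ht (hl.injective (h.trans h0.symm))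
  have hd : ∀ t : ℂ, t ≠ 0 → DifferentiableAt ℂ (fun t : ℂ => (κ t⁻¹)⁻¹) t := by
    intro t ht
    have h1 : DifferentiableAt ℂ (fun t : ℂ => κ t⁻¹) t :=
      (hκ _).comp t (differentiableAt_inv ht)
    exact h1.inv (hne _ (inv_ne_zero ht))
  intro t
  by_cases ht : t = 0
  · subst ht
    refine (Complex.analyticAt_of_differentiable_on_punctured_nhds_of_continuousAt ?_ ?_).differentiableAt
    · exact eventually_mem_nhdsWithin.mono fun t ht => hd t ht
    · have hprop : Tendsto κ (cocompact ℂ) (cocompact ℂ) := by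
        rw [hasBasis_cocompact.tendsto_right_iff]
        intro K hK
        have := (hK.image hμ).compl_mem_cocompact
        filter_upwards [this] with t ht hk
        exact ht ⟨κ t, hk, hl t⟩
      rw [← Metric.cobounded_eq_cocompact] at hprop
      rw [continuousAt_iff_punctured_nhds]
      simp only [inv_zero, h0]
      exact (tendsto_inv₀_cobounded.comp hprop).comp tendsto_inv₀_nhdsNE_zero
  · exact hd t ht

lemma aux_one_dim {κ μ : ℂ → ℂ} (hκ : Differentiable ℂ κ) (hμ : Differentiable ℂ μ)
    (hl : Function.LeftInverse μ κ) (hr : Function.RightInverse μ κ) (h0 : κ 0 = 0)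
    (h1 : deriv κ 0 = 1) (t : ℂ) : κ t = t := by
  have hμ0 : μ 0 = 0 := by simpa [h0] using hl 0
  have hq := aux_recip hκ hμ.continuous hl h0
  have hp := aux_recip hμ hκ.continuous hr hμ0
  set q : ℂ → ℂ := fun t => (κ t⁻¹)⁻¹ with hqdef
  set p : ℂ → ℂ := fun t => (μ t⁻¹)⁻¹ with hpdef
  have hpq : ∀ t, p (q t) = t := by intro t; simp [p, q, hl t⁻¹]
  have hq0 : q 0 = 0 := by simp [q, h0]
  have hc : deriv q 0 ≠ 0 := by
    intro h
    have h2 : HasDerivAt (fun t => p (q t)) (deriv p (q 0) * deriv q 0) 0 :=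
      (hp (q 0)).hasDerivAt.comp 0 (hq 0).hasDerivAt
    simp only [hpq, h, mul_zero] at h2
    exact zero_ne_one (h2.unique (hasDerivAt_id (0:ℂ)))
  have hψ : Differentiable ℂ (dslope κ 0) := by
    rw [← differentiableOn_univ, Complex.differentiableOn_dslope univ_mem]
    exact hκ.differentiableOn
  have hlim : Tendsto (dslope κ 0) (cocompact ℂ) (𝓝 (deriv q 0)⁻¹) := by
    have h2 := ((hq 0).hasDerivAt.tendsto_slope.inv₀ hc).comp tendsto_inv₀_cobounded'
    rw [← Metric.cobounded_eq_cocompact]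
    refine h2.congr' ?_
    have : ∀ᶠ t in Bornology.cobounded ℂ, t ≠ 0 := Bornology.eventually_ne_cobounded 0
    filter_upwards [this] with t ht
    simp [dslope_of_ne _ ht, slope_def_field, q, h0]
    field_simp
  have h2 := fun s => hψ.apply_eq_of_tendsto_cocompact s hlim
  have h3 := (h2 t).trans (h2 0).symm
  rw [dslope_same, h1] at h3
  by_cases ht : t = 0
  · rw [ht, h0]
  · rw [dslope_of_ne _ ht, slope_def_field, h0, sub_zero, sub_zero, div_eq_one_iff_eq ht] at h3
    exact h3

open scoped ComplexConjugate

/-- polarization -/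
lemma aux_polar {n : ℕ} {p q : EuclideanSpace ℂ (Fin n) → EuclideanSpace ℂ (Fin n)}
    {B : Set (EuclideanSpace ℂ (Fin n))} (hBo : IsOpen B) (hBc : Convex ℝ B)
    (hp : DifferentiableOn ℂ p B) (hq : DifferentiableOn ℂ q B)
    (h : ∀ z ∈ B, ‖p z‖ = ‖q z‖) : ∀ z ∈ B, ∀ w ∈ B, inner ℂ (p z) (p w) = inner ℂ (q z) (q w) := by
  intro z hz w hw
  set m : EuclideanSpace ℂ (Fin n) := (1/2 : ℝ) • z + (1/2 : ℝ) • w with hm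
  set d : EuclideanSpace ℂ (Fin n) := (Complex.I / 2) • (z - w) with hd
  have e1 : m + Complex.I • d = w := by
    ext i
    simp [m, d]
    linear_combination (1/2) * (z i - w i) * Complex.I_mul_I
  have e2 : m + (conj Complex.I) • d = z := by
    ext i
    simp [m, d]
    linear_combination (-1/2) * (z i - w i) * Complex.I_mul_I
  have hmB : m ∈ B := hBc hz hw (by norm_num) (by norm_num) (by norm_num)
  set T : Set ℂ := {t | m + t • d ∈ B ∧ m + (conj t) • d ∈ B} with hT
  have hc1 : Continuous (fun t : ℂ => m + t • d) := by fun_prop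
  have hc2 : Continuous (fun t : ℂ => m + (conj t) • d) := by
    exact continuous_const.add (Complex.continuous_conj.smul continuous_const)
  have hTo : IsOpen T := (hBo.preimage hc1).inter (hBo.preimage hc2)
  have hTc : Convex ℝ T := by
    intro s hs t ht a b ha hb hab
    constructor
    · convert hBc hs.1 ht.1 ha hb hab using 1
      ext i
      simp
      linear_combination (-(m i)) * (congrArg (fun x : ℝ => (x : ℂ)) hab |>.trans Complex.ofReal_one) + (m i) * (Complex.ofReal_add a b)
    · convert hBc hs.2 ht.2 ha hb hab using 1
      ext i
      simp
      linear_combination (-(m i)) * (congrArg (fun x : ℝ => (x : ℂ)) hab |>.trans Complex.ofReal_one) + (m i) * (Complex.ofReal_add a b)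
  have h0T : (0:ℂ) ∈ T := by simp [T, hmB]
  have hIT : Complex.I ∈ T := by
    refine ⟨?_, ?_⟩
    · rw [e1]; exact hw
    · rw [e2]; exact hz
  have hdiff : ∀ r : EuclideanSpace ℂ (Fin n) → EuclideanSpace ℂ (Fin n), DifferentiableOn ℂ r B → 
      AnalyticOnNhd ℂ (fun t : ℂ => inner ℂ (r (m + (conj t) • d)) (r (m + t • d))) T := by
    intro r hr
    refine DifferentiableOn.analyticOnNhd ?_ hTo
    intro t ht
    refine DifferentiableAt.differentiableWithinAt ?_
    simp only [PiLp.inner_apply, RCLike.inner_apply]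
    have hcoord : ∀ i, ∀ s : ℂ, m + s • d ∈ B → 
        DifferentiableAt ℂ (fun t : ℂ => r (m + t • d) i) s := by
      intro i s hs
      have h1 : DifferentiableAt ℂ (fun t : ℂ => r (m + t • d)) s := 
        ((hr _ hs).differentiableAt (hBo.mem_nhds hs)).comp s (by fun_prop)
      exact (differentiableAt_piLp 2).1 h1 i
    refine DifferentiableAt.fun_sum fun i _ => ?_
    refine (hcoord i t ht.1).mul ?_
    have := (hcoord i (conj t) ht.2).conj_conj
    simpa [Function.comp_def] using this
  have hreal : ∃ᶠ t in 𝓝[≠] (0:ℂ), inner ℂ (p (m + (conj t) • d)) (p (m + t • d)) =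
      inner ℂ (q (m + (conj t) • d)) (q (m + t • d)) := by
    have htend : Tendsto (fun x : ℝ => (x : ℂ)) (𝓝[≠] 0) (𝓝[≠] 0) := by
      refine tendsto_nhdsWithin_iff.2 ⟨?_, ?_⟩
      · exact (Complex.continuous_ofReal.tendsto' 0 0 (by simp)).mono_left nhdsWithin_le_nhds
      · filter_upwards [self_mem_nhdsWithin] with x hx
        simpa using hx
    refine htend.frequently (Eventually.frequently ?_)
    have : ∀ᶠ x : ℝ in 𝓝[≠] 0, (x : ℂ) ∈ T := 
      htend.eventually (nhdsWithin_le_nhds (hTo.mem_nhds h0T))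
    filter_upwards [this] with x hx
    simp only [Complex.conj_ofReal, inner_self_eq_norm_sq_to_K, h _ hx.1]
  have := (hdiff p hp).eqOn_of_preconnected_of_frequently_eq (hdiff q hq) hTc.isPreconnected h0T 
    hreal hIT
  simpa only [e1, e2] using this

lemma aux_ident {n : ℕ} {P Q : EuclideanSpace ℂ (Fin n) → ℂ} (hP : Differentiable ℂ P)
    (hQ : Differentiable ℂ Q) {B : Set (EuclideanSpace ℂ (Fin n))} (hBo : IsOpen B) 
    {z₀ : EuclideanSpace ℂ (Fin n)} (hz₀ : z₀ ∈ B) (h : ∀ z ∈ B, P z = Q z) (w : EuclideanSpace ℂ (Fin n)) :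
    P w = Q w := by
  have hP' : Differentiable ℂ (fun t : ℂ => P (z₀ + t • (w - z₀))) := by fun_prop
  have hQ' : Differentiable ℂ (fun t : ℂ => Q (z₀ + t • (w - z₀))) := by fun_prop
  have hc : Continuous (fun t : ℂ => z₀ + t • (w - z₀)) := by fun_prop
  have := AnalyticOnNhd.eq_of_eventuallyEq (z₀ := 0) (fun t _ => hP'.analyticAt t)
    (fun t _ => hQ'.analyticAt t) (by
      filter_upwards [(hBo.preimage hc).mem_nhds (show (0:ℂ) ∈ _ by simpa using hz₀)] with t ht
      exact h _ ht)
  simpa using congrFun this 1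

/-- four point identity, global -/
lemma aux_four {n : ℕ} {f g : EuclideanSpace ℂ (Fin n) → EuclideanSpace ℂ (Fin n)}
    (hf : Differentiable ℂ f) (hg : Differentiable ℂ g)
    {φ : EuclideanSpace ℂ (Fin n) → ℂ} {B : Set (EuclideanSpace ℂ (Fin n))} (hBo : IsOpen B) 
    {z₀ : EuclideanSpace ℂ (Fin n)} (hz₀ : z₀ ∈ B) 
    (h : ∀ z ∈ B, ∀ w ∈ B, inner ℂ (f z) (f w) = inner ℂ (φ z • g z) (φ w • g w)) 
    (z w a b : EuclideanSpace ℂ (Fin n)) :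
    inner ℂ (f z) (f w) * inner ℂ (f a) (f b) * inner ℂ (g z) (g b) * inner ℂ (g a) (g w) = 
    inner ℂ (f z) (f b) * inner ℂ (f a) (f w) * inner ℂ (g z) (g w) * inner ℂ (g a) (g b) := by
  have hf' : ∀ x, Differentiable ℂ (fun y => inner ℂ x (f y)) := fun x => 
    (innerSL ℂ x).differentiable.comp hf
  have hg' : ∀ x, Differentiable ℂ (fun y => inner ℂ x (g y)) := fun x => 
    (innerSL ℂ x).differentiable.comp hg
  have s1 : ∀ z ∈ B, ∀ w ∈ B, ∀ a ∈ B, ∀ b ∈ B, 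
      inner ℂ (f z) (f w) * inner ℂ (f a) (f b) * inner ℂ (g z) (g b) * inner ℂ (g a) (g w) = 
      inner ℂ (f z) (f b) * inner ℂ (f a) (f w) * inner ℂ (g z) (g w) * inner ℂ (g a) (g b) := by
    intro z hz w hw a ha b hb
    rw [h z hz w hw, h z hz b hb, h a ha w hw, h a ha b hb]
    simp only [inner_smul_left, inner_smul_right]
    ring
  have s2 : ∀ z ∈ B, ∀ a ∈ B, ∀ b ∈ B, ∀ w, 
      inner ℂ (f z) (f w) * inner ℂ (f a) (f b) * inner ℂ (g z) (g b) * inner ℂ (g a) (g w) = 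
      inner ℂ (f z) (f b) * inner ℂ (f a) (f w) * inner ℂ (g z) (g w) * inner ℂ (g a) (g b) := by
    intro z hz a ha b hb
    refine aux_ident ?_ ?_ hBo hz₀ (fun w hw => s1 z hz w hw a ha b hb)
    · exact ((((hf' _).mul_const _).mul_const _).mul (hg' _))
    · exact (((hf' _).const_mul _).mul (hg' _)).mul_const _
  have s3 : ∀ z ∈ B, ∀ a ∈ B, ∀ w b,
      inner ℂ (f z) (f w) * inner ℂ (f a) (f b) * inner ℂ (g z) (g b) * inner ℂ (g a) (g w) = 
      inner ℂ (f z) (f b) * inner ℂ (f a) (f w) * inner ℂ (g z) (g w) * inner ℂ (g a) (g b) := by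
    intro z hz a ha w
    refine aux_ident ?_ ?_ hBo hz₀ (fun b hb => s2 z hz a ha b hb w)
    · exact ((((hf' _).const_mul _).mul (hg' _)).mul_const _)
    · exact (((hf' _).mul_const _).mul_const _).mul (hg' _)
  have t1 : ∀ z ∈ B, ∀ a ∈ B, ∀ w b,
      inner ℂ (f w) (f z) * inner ℂ (f b) (f a) * inner ℂ (g b) (g z) * inner ℂ (g w) (g a) = 
      inner ℂ (f b) (f z) * inner ℂ (f w) (f a) * inner ℂ (g w) (g z) * inner ℂ (g b) (g a) := by
    intro z hz a ha w b
    have := congrArg conj (s3 z hz a ha w b)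
    simpa only [map_mul, inner_conj_symm] using this
  have t2 : ∀ a ∈ B, ∀ w b z, 
      inner ℂ (f w) (f z) * inner ℂ (f b) (f a) * inner ℂ (g b) (g z) * inner ℂ (g w) (g a) = 
      inner ℂ (f b) (f z) * inner ℂ (f w) (f a) * inner ℂ (g w) (g z) * inner ℂ (g b) (g a) := by
    intro a ha w b
    refine aux_ident ?_ ?_ hBo hz₀ (fun z hz => t1 z hz a ha w b)
    · exact ((((hf' _).mul_const _).mul (hg' _)).mul_const _)
    · exact ((((hf' _).mul_const _).mul (hg' _)).mul_const _)
  have t3 : ∀ w b z a, 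
      inner ℂ (f w) (f z) * inner ℂ (f b) (f a) * inner ℂ (g b) (g z) * inner ℂ (g w) (g a) = 
      inner ℂ (f b) (f z) * inner ℂ (f w) (f a) * inner ℂ (g w) (g z) * inner ℂ (g b) (g a) := by
    intro w b z
    refine aux_ident ?_ ?_ hBo hz₀ (fun a ha => t2 a ha w b z)
    · exact ((((hf' _).const_mul _).mul_const _).mul (hg' _))
    · exact (((hf' _).const_mul _).mul_const _).mul (hg' _)
  have := t3 z a w b
  linear_combination this

lemma aux_slope {n : ℕ} {f : EuclideanSpace ℂ (Fin n) → EuclideanSpace ℂ (Fin n)}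
    (hf : HasFDerivAt f (ContinuousLinearMap.id ℂ _) 0) (h0 : f 0 = 0) (v : EuclideanSpace ℂ (Fin n)) :
    Tendsto (fun t : ℂ => t⁻¹ • f (t • v)) (𝓝[≠] 0) (𝓝 v) := by
  have h1 : HasDerivAt (fun t : ℂ => t • v) v 0 := by
    simpa using (hasDerivAt_id (0:ℂ)).smul_const v
  have h2 : HasDerivAt (fun t : ℂ => f (t • v)) v 0 := by
    have h3 : HasFDerivAt f (ContinuousLinearMap.id ℂ _) ((0:ℂ) • v) := by simpa using hf
    simpa [Function.comp_def] using h3.comp_hasDerivAt (0:ℂ) h1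
  have := h2.tendsto_slope
  refine this.congr fun t => ?_
  simp [slope_def_module, h0]

lemma aux_parallel {n : ℕ} {f g : EuclideanSpace ℂ (Fin n) → EuclideanSpace ℂ (Fin n)}
    (hf : HasFDerivAt f (ContinuousLinearMap.id ℂ _) 0) (hf0 : f 0 = 0)
    (hg : HasFDerivAt g (ContinuousLinearMap.id ℂ _) 0) (hg0 : g 0 = 0)
    (h : ∀ z w a b, 
    inner ℂ (f z) (f w) * inner ℂ (f a) (f b) * inner ℂ (g z) (g b) * inner ℂ (g a) (g w) = 
    inner ℂ (f z) (f b) * inner ℂ (f a) (f w) * inner ℂ (g z) (g w) * inner ℂ (g a) (g b))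
    (z : EuclideanSpace ℂ (Fin n)) (hz : g z ≠ 0) : ∃ c : ℂ, f z = c • g z := by
  have key : ∀ ω α β : EuclideanSpace ℂ (Fin n), 
      inner ℂ (f z) ω * inner ℂ α β * inner ℂ (g z) β * inner ℂ α ω = 
      inner ℂ (f z) β * inner ℂ α ω * inner ℂ (g z) ω * inner ℂ α β := by
    intro ω α β
    have F1 := aux_slope hf hf0 ω
    have F2 := aux_slope hf hf0 α
    have F3 := aux_slope hf hf0 β
    have G1 := aux_slope hg hg0 ω
    have G2 := aux_slope hg hg0 α
    have G3 := aux_slope hg hg0 β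
    have L := (((tendsto_const_nhds (x := f z)).inner (𝕜 := ℂ) F1).mul (F2.inner (𝕜 := ℂ) F3)).mul
      ((tendsto_const_nhds (x := g z)).inner (𝕜 := ℂ) G3) |>.mul (G2.inner (𝕜 := ℂ) G1)
    have R := (((tendsto_const_nhds (x := f z)).inner (𝕜 := ℂ) F3).mul (F2.inner (𝕜 := ℂ) F1)).mul
      ((tendsto_const_nhds (x := g z)).inner (𝕜 := ℂ) G1) |>.mul (G2.inner (𝕜 := ℂ) G3)
    refine tendsto_nhds_unique (L.congr fun t => ?_) R
    simp only [inner_smul_left, inner_smul_right]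
    linear_combination (t⁻¹)^4 * (conj t⁻¹)^2 * h z (t • ω) (t • α) (t • β)
  set b := g z with hb
  have hbb : (inner ℂ b b : ℂ) ≠ 0 := inner_self_ne_zero.2 hz
  set c : ℂ := inner ℂ b (f z) / inner ℂ b b with hc
  set ω := f z - c • b with hω
  have h1 : inner ℂ b ω = 0 := by
    simp only [ω, inner_sub_right, inner_smul_right, c]
    field_simp
    ring
  have h1' : inner ℂ ω b = 0 := by rw [← inner_conj_symm, h1, map_zero]
  have hfz : f z = ω + c • b := by simp [ω]
  have k := key ω (b + ω) b
  rw [h1, hfz] at k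
  simp only [inner_add_left, inner_smul_left, h1, h1', mul_zero, zero_mul, add_zero, zero_add] at k
  have : (inner ℂ ω ω : ℂ) = 0 := by
    by_contra hne
    exact (mul_ne_zero (mul_ne_zero (mul_ne_zero hne hbb) hbb) hne) k
  have hω0 : ω = 0 := inner_self_eq_zero.1 this
  exact ⟨c, by rw [hfz, hω0, zero_add]⟩

lemma aux_pluri {n : ℕ} {u : EuclideanSpace ℂ (Fin n) → ℝ} {B : Set (EuclideanSpace ℂ (Fin n))}
    (hBo : IsOpen B) (hBc : Convex ℝ B) (hu : ∀ z ∈ B, ContDiffAt ℝ 2 u z)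
    (hsymm : ∀ z ∈ B, ∀ v w, fderiv ℝ (fderiv ℝ u) z (Complex.I • v) w =
      fderiv ℝ (fderiv ℝ u) z v (Complex.I • w)) :
    ∃ h : EuclideanSpace ℂ (Fin n) → ℂ, DifferentiableOn ℂ h B ∧ ∀ z ∈ B, (h z).re = u z := by
  rcases B.eq_empty_or_nonempty with rfl | ⟨z₀, hz₀⟩
  · exact ⟨0, by simp, by simp⟩
  let J : EuclideanSpace ℂ (Fin n) →L[ℝ] EuclideanSpace ℂ (Fin n) :=
    (Complex.I • ContinuousLinearMap.id ℂ (EuclideanSpace ℂ (Fin n))).restrictScalars ℝ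
  let C : (EuclideanSpace ℂ (Fin n) →L[ℝ] ℝ) →L[ℝ] (EuclideanSpace ℂ (Fin n) →L[ℝ] ℂ) :=
    ContinuousLinearMap.compL ℝ _ ℝ ℂ Complex.ofRealCLM
  let L : (EuclideanSpace ℂ (Fin n) →L[ℝ] ℝ) →L[ℝ] (EuclideanSpace ℂ (Fin n) →L[ℝ] ℂ) :=
    C - (ContinuousLinearMap.compL ℝ _ ℝ ℂ (Complex.I • Complex.ofRealCLM)) ∘L
      ((ContinuousLinearMap.compL ℝ _ _ ℝ).flip J)
  have hL : ∀ l v, L l v = (l v : ℂ) - Complex.I * (l (Complex.I • v) : ℂ) := by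
    intro l v
    simp [L, C, J]
  have hd2 : ∀ z ∈ B, DifferentiableAt ℝ (fderiv ℝ u) z := fun z hz =>
    ((hu z hz).fderiv_right (m := 1) (by norm_num)).differentiableAt (by norm_num)
  have hω : ∀ z ∈ B, HasFDerivAt (fun z => L (fderiv ℝ u z)) (L ∘L fderiv ℝ (fderiv ℝ u) z) z :=
    fun z hz => L.hasFDerivAt.comp z (hd2 z hz).hasFDerivAt
  obtain ⟨h, hh⟩ := hBc.exists_forall_hasFDerivAt_of_fderiv_symmetric hBo
    (ω := fun z => L (fderiv ℝ u z))
    (fun z hz => (hω z hz).differentiableAt.differentiableWithinAt) (by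
      intro a ha x y
      have hs : ∀ v w, fderiv ℝ (fderiv ℝ u) a v w = fderiv ℝ (fderiv ℝ u) a w v := 
        (hu a ha).isSymmSndFDerivAt (by simp)
      rw [(hω a ha).fderiv]
      simp only [ContinuousLinearMap.comp_apply, hL]
      rw [hs x y, ← hsymm a ha x y, hs _ y])
  have hre : ∀ z ∈ B, HasFDerivAt (fun z => (h z).re) (fderiv ℝ u z) z := by
    intro z hz
    have := Complex.reCLM.hasFDerivAt.comp z (hh z hz)
    have e : Complex.reCLM ∘L L (fderiv ℝ u z) = fderiv ℝ u z := by
      ext v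
      simp [hL]
    rw [e] at this
    exact this
  have hud : ∀ z ∈ B, DifferentiableAt ℝ u z := fun z hz => (hu z hz).differentiableAt (by norm_num)
  obtain ⟨c, hc⟩ := hBo.exists_eq_add_of_fderiv_eq (𝕜 := ℝ) (f := fun z => (h z).re) (g := u)
    hBc.isPreconnected
    (fun z hz => (hre z hz).differentiableAt.differentiableWithinAt)
    (fun z hz => (hud z hz).differentiableWithinAt) (fun z hz => (hre z hz).fderiv)
  refine ⟨fun z => h z - c, ?_, ?_⟩
  · intro z hz
    refine DifferentiableAt.differentiableWithinAt (DifferentiableAt.sub_const ?_ _)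
    refine (hasFDerivAt_of_restrictScalars ℝ (hh z hz)
      (f' := StrongDual.extendRCLike (𝕜 := ℂ) (fderiv ℝ u z)) ?_).differentiableAt
    ext v
    simp [hL, StrongDual.extendRCLike_apply]
  · intro z hz
    have := hc hz
    simp at this
    simp [this]

lemma aux_contDiff_log {n : ℕ} {f : EuclideanSpace ℂ (Fin n) → EuclideanSpace ℂ (Fin n)}
    (hf : Differentiable ℂ f) (z : EuclideanSpace ℂ (Fin n)) (hz : f z ≠ 0) :
    ContDiffAt ℝ 2 (fun x => Real.log ‖f x‖) z := by
  have h1 : ContDiffAt ℝ 2 f z := ((aux_contDiff hf).restrict_scalars ℝ).contDiffAt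
  exact (h1.norm ℂ hz).log (norm_ne_zero_iff.2 hz)

lemma aux_levi {n : ℕ} {u₁ u₂ : EuclideanSpace ℂ (Fin n) → ℝ} {z v w : EuclideanSpace ℂ (Fin n)}
    (h₁ : ContDiffAt ℝ 2 u₁ z) (h₂ : ContDiffAt ℝ 2 u₂ z) (h : levi u₁ z v w = levi u₂ z v w) :
    fderiv ℝ (fderiv ℝ (fun x => u₁ x - u₂ x)) z (Complex.I • v) w =
      fderiv ℝ (fderiv ℝ (fun x => u₁ x - u₂ x)) z v (Complex.I • w) := by
  have e : ∀ a b, fderiv ℝ (fderiv ℝ (fun x => u₁ x - u₂ x)) z a b = 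
      iteratedFDeriv ℝ 2 u₁ z ![a, b] - iteratedFDeriv ℝ 2 u₂ z ![a, b] := by
    intro a b
    have h1 := iteratedFDeriv_two_apply (𝕜 := ℝ) (fun x => u₁ x - u₂ x) z ![a, b]
    have h2 : iteratedFDeriv ℝ 2 (fun x => u₁ x - u₂ x) z = _ :=
      iteratedFDeriv_sub_apply (i := 2) h₁ h₂
    rw [h2] at h1
    simpa using h1.symm
  rw [e, e]
  have him := congrArg Complex.im h
  have hq : ∀ a b : ℝ, ((1/4 : ℂ) * ((a : ℂ) + Complex.I * (b : ℂ))).im = b / 4 := by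
    intro a b
    simp
    ring
  unfold levi at him
  rw [hq, hq] at him
  linarith

lemma aux_id {n : ℕ} {k l : EuclideanSpace ℂ (Fin n) → EuclideanSpace ℂ (Fin n)}
    (hk : Differentiable ℂ k) (hl : Differentiable ℂ l) (hlk : Function.LeftInverse l k)
    (hkl : Function.RightInverse l k) (hk0 : k 0 = 0)
    (hk1 : HasFDerivAt k (ContinuousLinearMap.id ℂ _) 0)
    (hpar : ∀ x, x ≠ 0 → ∃ c : ℂ, k x = c • x) (v : EuclideanSpace ℂ (Fin n)) : k v = v := by
  by_cases hv : v = 0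
  · rw [hv, hk0]
  have hl0 : l 0 = 0 := by simpa [hk0] using hlk 0
  have hparl : ∀ x, x ≠ 0 → ∃ c : ℂ, l x = c • x := by
    intro x hx
    have hlx : l x ≠ 0 := fun h => hx (by have := hkl x; rw [h, hk0] at this; exact this.symm)
    obtain ⟨c, hc⟩ := hpar _ hlx
    rw [hkl x] at hc
    have hc0 : c ≠ 0 := by rintro rfl; simp at hc; exact hx hc
    exact ⟨c⁻¹, by rw [eq_inv_smul_iff₀ hc0, ← hc]⟩
  have hvv : (inner ℂ v v : ℂ) ≠ 0 := inner_self_ne_zero.2 hv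
  let red : (EuclideanSpace ℂ (Fin n) → EuclideanSpace ℂ (Fin n)) → ℂ → ℂ := fun r t =>
    inner ℂ v (r (t • v)) / inner ℂ v v
  have hred : ∀ r : EuclideanSpace ℂ (Fin n) → EuclideanSpace ℂ (Fin n), r 0 = 0 →
      (∀ x, x ≠ 0 → ∃ c : ℂ, r x = c • x) → ∀ t, r (t • v) = red r t • v := by
    intro r h0 hp t
    by_cases ht : t = 0
    · simp [ht, h0, red]
    · obtain ⟨c, hc⟩ := hp (t • v) (smul_ne_zero ht hv)
      simp only [red, hc, inner_smul_right, smul_smul]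
      congr 1
      field_simp
  have hrd : ∀ r : EuclideanSpace ℂ (Fin n) → EuclideanSpace ℂ (Fin n), Differentiable ℂ r →
      Differentiable ℂ (red r) := by
    intro r hr
    have h1 : Differentiable ℂ (fun t : ℂ => r (t • v)) := by fun_prop
    exact ((innerSL ℂ v).differentiable.comp h1).div_const _
  have hk' := hred k hk0 hpar
  have hl' := hred l hl0 hparl
  have hinj : ∀ s t : ℂ, s • v = t • v → s = t := fun s t h => smul_left_injective ℂ hv h
  have hder : HasDerivAt (red k) 1 0 := by
    have h1 : HasDerivAt (fun t : ℂ => t • v) v 0 := by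
      simpa using (hasDerivAt_id (0:ℂ)).smul_const v
    have h2 : HasDerivAt (fun t : ℂ => k (t • v)) v 0 := by
      have h3 : HasFDerivAt k (ContinuousLinearMap.id ℂ _) ((0:ℂ) • v) := by simpa using hk1
      simpa [Function.comp_def] using h3.comp_hasDerivAt (0:ℂ) h1
    have h4 := ((innerSL ℂ v).hasFDerivAt.comp_hasDerivAt (0:ℂ) h2).div_const (inner ℂ v v)
    rw [innerSL_apply_apply, div_self hvv] at h4
    exact h4
  have := aux_one_dim (hrd k hk) (hrd l hl) 
    (fun t => hinj _ _ (by rw [← hl', ← hk', hlk]))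
    (fun t => hinj _ _ (by rw [← hk', ← hl', hkl])) (by simp [red, hk0]) hder.deriv 1
  have h5 := hk' 1
  rw [this] at h5
  simpa using h5

lemma aux_norm {n : ℕ} {f g fi gi : EuclideanSpace ℂ (Fin n) → EuclideanSpace ℂ (Fin n)}
    (hf : Differentiable ℂ f) (hg : Differentiable ℂ g)
    (hfi : Differentiable ℂ fi) (hgi : Differentiable ℂ gi)
    (hfl : Function.LeftInverse fi f) (hfr : Function.RightInverse fi f)
    (hgl : Function.LeftInverse gi g) (hgr : Function.RightInverse gi g)
    (hf0 : f 0 = 0) (hg0 : g 0 = 0)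
    (hf1 : HasFDerivAt f (ContinuousLinearMap.id ℂ _) 0)
    (hg1 : HasFDerivAt g (ContinuousLinearMap.id ℂ _) 0)
    (h : ∀ z, z ≠ 0 → ∀ v w, levi (fun x => Real.log ‖f x‖) z v w =
      levi (fun x => Real.log ‖g x‖) z v w) : f = g := by
  rcases subsingleton_or_nontrivial (EuclideanSpace ℂ (Fin n)) with hs | hs
  · exact funext fun x => Subsingleton.elim _ _
  obtain ⟨z₀, hz₀⟩ := exists_ne (0 : EuclideanSpace ℂ (Fin n))
  have hfne : ∀ z, z ≠ 0 → f z ≠ 0 := fun z hz e => hz (hfl.injective (e.trans hf0.symm))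
  have hgne : ∀ z, z ≠ 0 → g z ≠ 0 := fun z hz e => hz (hgl.injective (e.trans hg0.symm))
  have hB0 : ∀ z ∈ ball z₀ ‖z₀‖, z ≠ 0 := by
    rintro z hz rfl
    simp at hz
  have hmem : z₀ ∈ ball z₀ ‖z₀‖ := mem_ball_self (norm_pos_iff.2 hz₀)
  obtain ⟨H, hH, hHre⟩ := aux_pluri (B := ball z₀ ‖z₀‖)
    (u := fun x => Real.log ‖f x‖ - Real.log ‖g x‖) isOpen_ball (convex_ball _ _)
    (fun z hz => (aux_contDiff_log hf z (hfne z (hB0 z hz))).sub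
      (aux_contDiff_log hg z (hgne z (hB0 z hz))))
    (fun z hz v w => aux_levi (aux_contDiff_log hf z (hfne z (hB0 z hz)))
      (aux_contDiff_log hg z (hgne z (hB0 z hz))) (h z (hB0 z hz) v w))
  have hpol := aux_polar (p := f) (q := fun z => Complex.exp (H z) • g z) isOpen_ball
    (convex_ball z₀ ‖z₀‖) hf.differentiableOn (hH.cexp.smul hg.differentiableOn) (by
      intro z hz
      have p1 := norm_pos_iff.2 (hfne z (hB0 z hz))
      have p2 := norm_pos_iff.2 (hgne z (hB0 z hz))
      rw [norm_smul, Complex.norm_exp, hHre z hz, Real.exp_sub, Real.exp_log p1, Real.exp_log p2]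
      field_simp)
  have hfour := aux_four (φ := fun z => Complex.exp (H z)) hf hg isOpen_ball hmem hpol
  have hpar := aux_parallel hf1 hf0 hg1 hg0 hfour
  have hgi0 : gi 0 = 0 := by simpa [hg0] using hgl 0
  have hgi1 : HasFDerivAt gi (ContinuousLinearMap.id ℂ _) 0 := by
    have h1 : HasFDerivAt (fun x => gi (g x)) (fderiv ℂ gi 0 ∘L ContinuousLinearMap.id ℂ _) 0 := by
      have h2 : HasFDerivAt gi (fderiv ℂ gi 0) (g 0) := by rw [hg0]; exact (hgi 0).hasFDerivAt
      exact h2.comp 0 hg1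
    have h3 : (fun x => gi (g x)) = id := funext hgl
    rw [h3] at h1
    have h4 := h1.unique (hasFDerivAt_id 0)
    rw [ContinuousLinearMap.comp_id] at h4
    rw [← h4]
    exact (hgi 0).hasFDerivAt
  have hk := aux_id (k := fun x => f (gi x)) (l := fun x => g (fi x)) (hf.comp hgi) (hg.comp hfi)
    (fun x => by simp [hfl (gi x), hgr x]) (fun x => by simp [hgl (fi x), hfr x])
    (by simp [hgi0, hf0])
    (by
      have h2 : HasFDerivAt f (ContinuousLinearMap.id ℂ _) (gi 0) := by rw [hgi0]; exact hf1
      exact h2.comp 0 hgi1)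
    (by
      intro x hx
      have := hpar (gi x) (by rw [hgr x]; exact hx)
      rwa [hgr x] at this)
  funext x
  have := hk (g x)
  simpa [hgl x] using this

/-- invertible derivative -/
lemma aux_equiv {n : ℕ} {F Fi : EuclideanSpace ℂ (Fin n) → EuclideanSpace ℂ (Fin n)}
    (hF : Differentiable ℂ F) (hFi : Differentiable ℂ Fi)
    (hl : Function.LeftInverse Fi F) (hr : Function.RightInverse Fi F) :
    ∃ A : EuclideanSpace ℂ (Fin n) ≃L[ℂ] EuclideanSpace ℂ (Fin n),
      (A : EuclideanSpace ℂ (Fin n) →L[ℂ] EuclideanSpace ℂ (Fin n)) = fderiv ℂ F 0 := by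
  have h1 : HasFDerivAt (fun x => Fi (F x)) (fderiv ℂ Fi (F 0) ∘L fderiv ℂ F 0) 0 :=
    (hFi (F 0)).hasFDerivAt.comp 0 (hF 0).hasFDerivAt
  have h2 : HasFDerivAt (fun x => F (Fi x)) (fderiv ℂ F 0 ∘L fderiv ℂ Fi (F 0)) (F 0) := by
    have h3 : HasFDerivAt F (fderiv ℂ F 0) (Fi (F 0)) := by rw [hl 0]; exact (hF 0).hasFDerivAt
    exact h3.comp (F 0) (hFi (F 0)).hasFDerivAt
  have e1 : (fun x => Fi (F x)) = id := funext hl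
  have e2 : (fun x => F (Fi x)) = id := funext hr
  rw [e1] at h1
  rw [e2] at h2
  have h4 := h1.unique (hasFDerivAt_id _)
  have h5 := h2.unique (hasFDerivAt_id _)
  exact ⟨ContinuousLinearEquiv.equivOfInverse (fderiv ℂ F 0) (fderiv ℂ Fi (F 0))
    (fun x => congrArg (fun T => T x) h4) (fun x => congrArg (fun T => T x) h5), by ext; rfl⟩

lemma aux_normalized {n : ℕ} {F Fi : EuclideanSpace ℂ (Fin n) → EuclideanSpace ℂ (Fin n)}
    (hF : Differentiable ℂ F) (hFi : Differentiable ℂ Fi)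
    (hl : Function.LeftInverse Fi F) (hr : Function.RightInverse Fi F)
    (A : EuclideanSpace ℂ (Fin n) ≃L[ℂ] EuclideanSpace ℂ (Fin n))
    (hA : (A : EuclideanSpace ℂ (Fin n) →L[ℂ] EuclideanSpace ℂ (Fin n)) = fderiv ℂ F 0) :
    Differentiable ℂ (fun x => A.symm (F x - F 0)) ∧ Differentiable ℂ (fun y => Fi (A y + F 0)) ∧
    Function.LeftInverse (fun y => Fi (A y + F 0)) (fun x => A.symm (F x - F 0)) ∧
    Function.RightInverse (fun y => Fi (A y + F 0)) (fun x => A.symm (F x - F 0)) ∧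
    HasFDerivAt (fun x => A.symm (F x - F 0)) (ContinuousLinearMap.id ℂ _) 0 := by
  refine ⟨?_, ?_, ?_, ?_, ?_⟩
  · exact A.symm.differentiable.comp (hF.sub_const _)
  · exact hFi.comp (A.differentiable.add_const _)
  · intro x; simp [hl x]
  · intro y; simp [hr (A y + F 0)]
  · have h1 : HasFDerivAt (fun x => F x - F 0) 
        (A : EuclideanSpace ℂ (Fin n) →L[ℂ] EuclideanSpace ℂ (Fin n)) 0 := by
      rw [hA]; exact (hF 0).hasFDerivAt.sub_const _
    have h2 := A.symm.hasFDerivAt.comp 0 h1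
    have e : (A.symm : EuclideanSpace ℂ (Fin n) →L[ℂ] EuclideanSpace ℂ (Fin n)) ∘L
        (A : EuclideanSpace ℂ (Fin n) →L[ℂ] EuclideanSpace ℂ (Fin n)) =
        ContinuousLinearMap.id ℂ _ := by
      ext; simp
    rw [e] at h2
    exact h2

theorem main_theorem {n : ℕ}
    (F G : EuclideanSpace ℂ (Fin n) → EuclideanSpace ℂ (Fin n))
    (hF : Differentiable ℂ F) (hG : Differentiable ℂ G)
    (Finv Ginv : EuclideanSpace ℂ (Fin n) → EuclideanSpace ℂ (Fin n))
    (hFinv : Differentiable ℂ Finv) (hGinv : Differentiable ℂ Ginv)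
    (hFl : Function.LeftInverse Finv F) (hFr : Function.RightInverse Finv F)
    (hGl : Function.LeftInverse Ginv G) (hGr : Function.RightInverse Ginv G) :
    F = G ↔
      (F 0 = G 0 ∧ fderiv ℂ F 0 = fderiv ℂ G 0 ∧
        ∀ z : EuclideanSpace ℂ (Fin n), z ≠ 0 → ∀ v w,
          levi (fun x => Real.log ‖(fderiv ℂ F 0).inverse (F x - F 0)‖) z v w
            = levi (fun x => Real.log ‖(fderiv ℂ G 0).inverse (G x - G 0)‖) z v w) := by
  constructor
  · rintro rfl
    exact ⟨rfl, rfl, fun _ _ _ _ => rfl⟩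
  · rintro ⟨h0, h1, h⟩
    obtain ⟨A, hA⟩ := aux_equiv hF hFinv hFl hFr
    rw [← h1, ← hA, ContinuousLinearMap.inverse_equiv] at h
    obtain ⟨a1, a2, a3, a4, a5⟩ := aux_normalized hF hFinv hFl hFr A hA
    obtain ⟨b1, b2, b3, b4, b5⟩ := aux_normalized hG hGinv hGl hGr A (hA.trans h1)
    have := aux_norm a1 b1 a2 b2 a3 a4 b3 b4 (by simp) (by simp) a5 b5 h
    funext x
    have hx := A.symm.injective (congrFun this x)
    rw [h0] at hx
    exact sub_left_injective hx
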